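/- Fix integers n ≥ 2 and t ≥ 3. There exists a positive constant κ depending only on n and t such that for all sufficiently large integers q, there exists a q-ary t̄-separable code of length n with at least κ · q^{n/(t−1)} codewords. -/

import Mathlib

def desc {F : Type*} {n : ℕ} (X : Set (Fin n → F)) : Set (Fin n → F) :=
  {y | ∀ k : Fin n, ∃ x ∈ X, y k = x k}

lemma sum_superset_pow_mul_pow {V : Type*} [Fintype V] [DecidableEq V] (p : ℝ) (T : Finset V) :
    ∑ S with T ⊆ S, p ^ S.card * (1 - p) ^ (Fintype.card V - S.card) = p ^ T.card := by
  have h : ∑ S with T ⊆ S, p ^ S.card * (1 - p) ^ (Fintype.card V - S.card) =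
      ∑ R ∈ Tᶜ.powerset, p ^ T.card * (p ^ R.card * (1 - p) ^ (Tᶜ.card - R.card)) := by
    refine Finset.sum_nbij' (fun S => S \ T) (fun R => T ∪ R) ?_ ?_ ?_ ?_ ?_
    · intro S _
      simp only [Finset.mem_powerset]
      intro a ha
      simp at ha ⊢
      exact ha.2
    · intro R _
      simp
    · intro S hS
      simp only [Finset.mem_filter, Finset.mem_univ, true_and] at hS
      exact Finset.union_sdiff_of_subset hS
    · intro R hR
      simp only [Finset.mem_powerset] at hR
      ext a
      have := @hR a
      simp only [Finset.mem_compl] at this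
      simp only [Finset.mem_sdiff, Finset.mem_union]
      tauto
    · intro S hS
      simp only [Finset.mem_filter, Finset.mem_univ, true_and] at hS
      have h1 := Finset.card_sdiff_add_card_eq_card hS
      have h2 := Finset.card_compl T
      rw [← mul_assoc, ← pow_add]
      congr 2 <;> omega
  rw [h, ← Finset.mul_sum, Finset.sum_pow_mul_eq_add_pow]
  simp

/-- The deletion method: a random `p`-subset of `V`, with one vertex removed from every edge it
contains. -/
lemma exists_independent_card_ge {V : Type*} [Fintype V] [DecidableEq V] {p : ℝ} (hp0 : 0 ≤ p)
    (hp1 : p ≤ 1) (E : Finset (Finset V)) (hE : ∀ T ∈ E, T.Nonempty) :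
    ∃ S : Finset V, (∀ T ∈ E, ¬ T ⊆ S) ∧
      p * Fintype.card V - ∑ T ∈ E, p ^ T.card ≤ S.card := by
  set w : Finset V → ℝ := fun S => p ^ S.card * (1 - p) ^ (Fintype.card V - S.card)
  have hw0 : ∀ S, 0 ≤ w S := fun S => mul_nonneg (pow_nonneg hp0 _) (pow_nonneg (by linarith) _)
  have hsup : ∀ T : Finset V, ∑ S : Finset V, (if T ⊆ S then w S else 0) = p ^ T.card := fun T => by
    rw [← Finset.sum_filter]; exact sum_superset_pow_mul_pow p T
  have hw1 : ∑ S, w S = 1 := by simpa using hsup ∅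
  set g : Finset V → ℝ := fun S => S.card - (E.filter (· ⊆ S)).card with hg
  have hwg : ∑ S, w S * g S = p * Fintype.card V - ∑ T ∈ E, p ^ T.card := by
    have h1 : ∀ S, w S * g S = ∑ v : V, (if {v} ⊆ S then w S else 0) -
        ∑ T ∈ E, (if T ⊆ S then w S else 0) := by
      intro S
      rw [← Finset.sum_filter, ← Finset.sum_filter, Finset.sum_const, Finset.sum_const]
      simp only [Finset.singleton_subset_iff, Finset.filter_univ_mem, nsmul_eq_mul, hg]
      ring
    simp only [h1]
    rw [Finset.sum_sub_distrib, Finset.sum_comm, Finset.sum_comm (s := Finset.univ) (t := E)]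
    simp only [hsup]
    simp [mul_comm]
  obtain ⟨S, -, hS⟩ := Finset.exists_max_image Finset.univ g ⟨∅, Finset.mem_univ _⟩
  have hle : p * Fintype.card V - ∑ T ∈ E, p ^ T.card ≤ g S := by
    rw [← hwg]
    calc ∑ R, w R * g R ≤ ∑ R, w R * g S :=
          Finset.sum_le_sum fun R hR => mul_le_mul_of_nonneg_left (hS R hR) (hw0 R)
      _ = g S := by rw [← Finset.sum_mul, hw1, one_mul]
  choose pick hpick using hE
  set B := (E.filter (· ⊆ S)).attach.image fun T =>
    pick T.1 (Finset.mem_filter.1 T.2).1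
  refine ⟨S \ B, ?_, hle.trans ?_⟩
  · intro T hT hTS
    have hTS' : T ⊆ S := hTS.trans Finset.sdiff_subset
    have := hTS (hpick T hT)
    rw [Finset.mem_sdiff] at this
    exact this.2 (Finset.mem_image.2
      ⟨⟨T, Finset.mem_filter.2 ⟨hT, hTS'⟩⟩, Finset.mem_attach _ _, rfl⟩)
  · have h1 := Finset.le_card_sdiff B S
    have h2 : B.card ≤ (E.filter (· ⊆ S)).card :=
      Finset.card_image_le.trans (Finset.card_attach).le
    have h3 : S.card ≤ (S \ B).card + (E.filter (· ⊆ S)).card := by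
      omega
    have h4 : (S.card : ℝ) ≤ (S \ B).card +
        (E.filter (· ⊆ S)).card := by exact_mod_cast h3
    simp only [hg]
    linarith

/-- The total number of symbols occurring in the words of `T`, counted coordinate by coordinate. -/
def symbolCount {F : Type*} [DecidableEq F] {n : ℕ} (T : Finset (Fin n → F)) : ℕ :=
  ∑ j, (T.image (· j)).card

lemma card_filter_symbolCount_le {F : Type*} [Fintype F] [Nonempty F] [DecidableEq F]
    (n m D : ℕ) :
    (Finset.univ.filter fun T : Finset (Fin n → F) => T.card = m ∧ symbolCount T ≤ D).card ≤
      (m ^ m) ^ n * Fintype.card F ^ D := by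
  classical
  have hsub : (Finset.univ.filter fun T : Finset (Fin n → F) => T.card = m ∧ symbolCount T ≤ D) ⊆
      (Finset.univ.filter fun φ : Fin n → Fin m → Fin m =>
        ∑ j, (Finset.univ.image (φ j)).card ≤ D).biUnion fun φ =>
          (Finset.univ : Finset (∀ j, {i // i ∈ Finset.univ.image (φ j)} → F)).image fun u =>
            Finset.univ.image fun i j =>
              u j ⟨φ j i, Finset.mem_image_of_mem _ (Finset.mem_univ i)⟩ := by
    intro T hT
    simp only [Finset.mem_filter, Finset.mem_univ, true_and] at hT
    obtain ⟨hTm, hTD⟩ := hT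
    let v : Fin m → Fin n → F := fun i => ((T.equivFinOfCardEq hTm).symm i : Fin n → F)
    have hv : Finset.univ.image v = T := by
      ext x
      simp only [Finset.mem_image, Finset.mem_univ, true_and]
      constructor
      · rintro ⟨i, rfl⟩
        exact Subtype.prop _
      · intro hx
        exact ⟨T.equivFinOfCardEq hTm ⟨x, hx⟩, by simp [v]⟩
    have hr : ∀ j, ∃ r : F → Fin m → Fin m, ∀ i, v (r (v i j) i) j = v i j ∧
        ∀ i', v i' j = v i j → r (v i j) i = r (v i' j) i' := by
      intro j
      refine ⟨fun a i => if h : ∃ i', v i' j = a then h.choose else i, fun i => ?_⟩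
      have h : ∃ i', v i' j = v i j := ⟨i, rfl⟩
      refine ⟨by simpa only [h, dif_pos] using h.choose_spec, fun i' hi' => ?_⟩
      rw [hi']
      simp only [h, dif_pos]
    choose r hr using hr
    simp only [Finset.mem_biUnion, Finset.mem_filter, Finset.mem_univ, true_and,
      Finset.mem_image]
    refine ⟨fun j i => r j (v i j) i, le_trans (Finset.sum_le_sum fun j _ => ?_) hTD,
      fun j i => v i j, ?_⟩
    · apply Finset.card_le_card_of_injOn (fun i => v i j)
      · intro i _
        simp only [Finset.coe_image, Set.mem_image, Finset.mem_coe]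
        exact ⟨v i, hv ▸ Finset.mem_image_of_mem _ (Finset.mem_univ i), rfl⟩
      · intro a ha b hb hab
        simp only [Finset.coe_image, Finset.coe_univ, Set.image_univ, Set.mem_range] at ha hb
        obtain ⟨i, rfl⟩ := ha
        obtain ⟨i', rfl⟩ := hb
        simp only [(hr j _).1] at hab
        exact (hr j i).2 i' hab.symm
    · simp only [(hr _ _).1]
      exact hv
  refine (Finset.card_le_card hsub).trans ((Finset.card_biUnion_le_card_mul _ _
    (Fintype.card F ^ D) fun φ hφ => ?_).trans (Nat.mul_le_mul_right _ ?_))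
  · refine Finset.card_image_le.trans ?_
    simp only [Finset.mem_filter, Finset.mem_univ, true_and] at hφ
    rw [Finset.card_univ, Fintype.card_pi]
    simp only [Fintype.card_fun, Fintype.card_coe]
    rw [Finset.prod_pow_eq_pow_sum]
    exact Nat.pow_le_pow_right Fintype.card_pos hφ
  · refine (Finset.card_le_univ _).trans ?_
    simp

/-- A large code in which every small set of words involves many symbols. -/
lemma exists_code_symbolCount (n t : ℕ) (ht : 2 ≤ t) :
    ∃ κ : ℝ, 0 < κ ∧ ∀ q : ℕ, 1 ≤ q → ∃ C : Finset (Fin n → Fin q),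
      (∀ T ⊆ C, 2 ≤ T.card → T.card ≤ t + 2 →
        (t - 1) * (T.card * n) < (T.card - 1) * n + (t - 1) * symbolCount T) ∧
      κ * (q : ℝ) ^ ((n : ℝ) / ((t : ℝ) - 1)) ≤ C.card := by
  classical
  set c : ℝ := ∑ m ∈ Finset.Icc 2 (t + 2), ((m ^ m) ^ n : ℝ) with hc
  have hc0 : 0 ≤ c := Finset.sum_nonneg fun m _ => by positivity
  set κ : ℝ := 1 / (2 * (c + 1)) with hκ
  have hκ0 : 0 < κ := by positivity
  have hκ1 : κ ≤ 1 := by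
    rw [hκ, div_le_one (by positivity)]
    linarith
  have hκc : κ * c ≤ 1 / 2 := by
    rw [hκ, div_mul_eq_mul_div, div_le_iff₀ (by positivity)]
    linarith
  refine ⟨κ / 2, by positivity, fun q hq => ?_⟩
  have : Nonempty (Fin q) := ⟨⟨0, hq⟩⟩
  have hq1 : (1 : ℝ) ≤ q := by exact_mod_cast hq
  have hq0 : (0 : ℝ) < q := by linarith
  set α : ℝ := (n : ℝ) / ((t : ℝ) - 1) with hα
  have ht1 : (1 : ℝ) ≤ (t : ℝ) - 1 := by
    have : (2 : ℝ) ≤ t := by exact_mod_cast ht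
    linarith
  have hαt : ((t : ℝ) - 1) * α = n := by rw [hα]; field_simp
  have hαn : α ≤ n := div_le_self (Nat.cast_nonneg n) ht1
  set p : ℝ := κ * (q : ℝ) ^ (α - n) with hp
  have hp0 : 0 ≤ p := by positivity
  have hp1 : p ≤ 1 :=
    mul_le_one₀ hκ1 (by positivity) (Real.rpow_le_one_of_one_le_of_nonpos hq1 (by linarith))
  set D : ℕ → ℕ := fun m => ⌊(m * n - (m - 1) * α : ℝ)⌋₊
  set E : Finset (Finset (Fin n → Fin q)) := (Finset.Icc 2 (t + 2)).biUnion fun m =>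
    Finset.univ.filter fun T => T.card = m ∧ symbolCount T ≤ D m with hE
  have hDnonneg : ∀ m ∈ Finset.Icc 2 (t + 2), (0 : ℝ) ≤ m * n - (m - 1) * α := by
    intro m hm
    have h2 : (2 : ℝ) ≤ m := by exact_mod_cast (Finset.mem_Icc.1 hm).1
    have : (0 : ℝ) ≤ n := Nat.cast_nonneg n
    nlinarith
  obtain ⟨C, hC, hcard⟩ := exists_independent_card_ge hp0 hp1 E (by
    intro T hT
    simp only [hE, Finset.mem_biUnion, Finset.mem_filter, Finset.mem_Icc] at hT
    obtain ⟨m, hm, -, hTm, -⟩ := hT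
    exact Finset.card_pos.1 (by omega))
  refine ⟨C, fun T hTC h2 hTt => ?_, le_trans ?_ hcard⟩
  · by_contra! hcon
    refine hC T ?_ hTC
    simp only [hE, Finset.mem_biUnion, Finset.mem_filter, Finset.mem_univ, true_and]
    refine ⟨T.card, Finset.mem_Icc.2 ⟨h2, hTt⟩, rfl, Nat.le_floor ?_⟩
    have hcon' : ((T.card : ℝ) - 1) * n + ((t : ℝ) - 1) * symbolCount T ≤
        ((t : ℝ) - 1) * (T.card * n) := by
      have : (((T.card - 1) * n + (t - 1) * symbolCount T : ℕ) : ℝ) ≤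
        ((t - 1) * (T.card * n) : ℕ) := by exact_mod_cast hcon
      push_cast [Nat.cast_sub (show 1 ≤ t by omega), Nat.cast_sub (show 1 ≤ T.card by omega)]
        at this
      exact this
    rw [← hαt] at hcon' ⊢
    refine le_of_mul_le_mul_left ?_ (by linarith : (0 : ℝ) < (t : ℝ) - 1)
    linarith
  · have hN : p * Fintype.card (Fin n → Fin q) = κ * (q : ℝ) ^ α := by
      rw [Fintype.card_fun, Fintype.card_fin, Fintype.card_fin, Nat.cast_pow, hp, mul_assoc,
        ← Real.rpow_natCast (q : ℝ) n, ← Real.rpow_add hq0]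
      congr 2
      ring
    have hsum : ∑ T ∈ E, p ^ T.card ≤ κ ^ 2 * c * (q : ℝ) ^ α := by
      calc ∑ T ∈ E, p ^ T.card
          ≤ ∑ m ∈ Finset.Icc 2 (t + 2), ∑ T : Finset (Fin n → Fin q) with
              T.card = m ∧ symbolCount T ≤ D m, p ^ T.card := by
            rw [hE]
            refine (Finset.sum_biUnion ?_).le
            intro a _ b _ hab
            refine Finset.disjoint_left.2 fun T h1 h2 => hab ?_
            simp only [Finset.mem_filter] at h1 h2
            exact h1.2.1.symm.trans h2.2.1
        _ ≤ ∑ m ∈ Finset.Icc 2 (t + 2), κ ^ 2 * ((m ^ m) ^ n : ℝ) * (q : ℝ) ^ α := by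
            refine Finset.sum_le_sum fun m hm => ?_
            have hcount := card_filter_symbolCount_le (F := Fin q) n m (D m)
            rw [Fintype.card_fin] at hcount
            have hcount' : ((Finset.univ.filter fun T : Finset (Fin n → Fin q) =>
                T.card = m ∧ symbolCount T ≤ D m).card : ℝ) ≤ (m ^ m) ^ n * (q : ℝ) ^ D m := by
              exact_mod_cast hcount
            have hDm : (q : ℝ) ^ D m ≤ (q : ℝ) ^ (m * n - (m - 1) * α : ℝ) := by
              rw [← Real.rpow_natCast]
              exact Real.rpow_le_rpow_of_exponent_le hq1 (Nat.floor_le (hDnonneg m hm))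
            have hpm : p ^ m ≤ κ ^ 2 * (q : ℝ) ^ ((α - n) * m) := by
              rw [hp, mul_pow, ← Real.rpow_mul_natCast hq0.le]
              exact mul_le_mul_of_nonneg_right
                (pow_le_pow_of_le_one hκ0.le hκ1 (Finset.mem_Icc.1 hm).1) (by positivity)
            calc ∑ T : Finset (Fin n → Fin q) with T.card = m ∧ symbolCount T ≤ D m, p ^ T.card
                = ∑ T : Finset (Fin n → Fin q) with T.card = m ∧ symbolCount T ≤ D m, p ^ m :=
                  Finset.sum_congr rfl fun T hT => by rw [(Finset.mem_filter.1 hT).2.1]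
              _ ≤ ((m ^ m) ^ n * (q : ℝ) ^ (m * n - (m - 1) * α : ℝ)) *
                    (κ ^ 2 * (q : ℝ) ^ ((α - n) * m)) := by
                  rw [Finset.sum_const, nsmul_eq_mul]
                  refine mul_le_mul (hcount'.trans ?_) hpm (by positivity) (by positivity)
                  exact mul_le_mul_of_nonneg_left hDm (by positivity)
              _ = κ ^ 2 * (m ^ m) ^ n *
                    ((q : ℝ) ^ (m * n - (m - 1) * α : ℝ) * (q : ℝ) ^ ((α - n) * m)) := by ring
              _ = κ ^ 2 * (m ^ m) ^ n * (q : ℝ) ^ α := by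
                  rw [← Real.rpow_add hq0]
                  congr 2
                  ring
        _ = κ ^ 2 * c * (q : ℝ) ^ α := by rw [← Finset.sum_mul, ← Finset.mul_sum]
    have hqα : 0 ≤ κ * (q : ℝ) ^ α := by positivity
    rw [hN]
    nlinarith

lemma image_eval_subset_of_desc_eq {F : Type*} [DecidableEq F] {n : ℕ}
    {X X' : Finset (Fin n → F)} (h : desc (X : Set (Fin n → F)) = desc (X' : Set (Fin n → F)))
    (k : Fin n) : X.image (· k) ⊆ X'.image (· k) := by
  intro a ha
  obtain ⟨x, hx, rfl⟩ := Finset.mem_image.1 ha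
  have hxd : x ∈ desc (X : Set (Fin n → F)) := fun k => ⟨x, hx, rfl⟩
  rw [h] at hxd
  obtain ⟨y, hy, hxy⟩ := hxd k
  exact Finset.mem_image.2 ⟨y, hy, hxy.symm⟩

lemma symbolCount_le_mul {F : Type*} [DecidableEq F] {n s : ℕ} {T : Finset (Fin n → F)}
    (h : ∀ j, (T.image (· j)).card ≤ s) : symbolCount T ≤ n * s := by
  simpa [symbolCount] using Finset.sum_le_card_nsmul Finset.univ _ s fun j _ => h j

lemma desc_ne_of_symbolCount {F : Type*} [DecidableEq F] {n t : ℕ} (ht : 3 ≤ t)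
    {C : Finset (Fin n → F)}
    (hC : ∀ T ⊆ C, 2 ≤ T.card → T.card ≤ t + 2 →
      (t - 1) * (T.card * n) < (T.card - 1) * n + (t - 1) * symbolCount T)
    {X X' : Finset (Fin n → F)} (hXC : X ⊆ C) (hXC' : X' ⊆ C) (hX : X.Nonempty)
    (hX' : X'.Nonempty) (hXt : X.card ≤ t) (hXt' : X'.card ≤ t) (hne : X ≠ X') :
    desc (X : Set (Fin n → F)) ≠ desc (X' : Set (Fin n → F)) := by
  intro h
  have himg : ∀ k, X.image (· k) = X'.image (· k) := fun k =>
    (image_eval_subset_of_desc_eq h k).antisymm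
      (image_eval_subset_of_desc_eq h.symm k)
  have hmem : ∀ x ∈ X, ∀ k, x k ∈ X'.image (· k) := fun x hx k =>
    himg k ▸ Finset.mem_image_of_mem (· k) hx
  have hmem' : ∀ x ∈ X', ∀ k, x k ∈ X.image (· k) := fun x hx k =>
    (himg k).symm ▸ Finset.mem_image_of_mem (· k) hx
  have hframe : ∀ Y ⊆ C, Y.Nonempty → ∀ x ∈ C, x ∉ Y → (∀ k, x k ∈ Y.image (· k)) →
      t ≤ Y.card := by
    intro Y hY hYne x hx hxY hk
    by_contra! hlt
    have hpos := hYne.card_pos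
    have hcard := Finset.card_insert_of_notMem hxY
    have h1 := hC (insert x Y) (Finset.insert_subset hx hY) (by omega) (by omega)
    have h2 : symbolCount (insert x Y) ≤ n * Y.card := symbolCount_le_mul fun j => by
      rw [Finset.image_insert, Finset.insert_eq_of_mem (hk j)]
      exact Finset.card_image_le
    rw [hcard] at h1
    obtain ⟨s, rfl⟩ : ∃ s, t = s + 1 := ⟨t - 1, by omega⟩
    simp only [Nat.add_sub_cancel] at h1
    have h3 : Y.card * n ≤ s * n := Nat.mul_le_mul_right _ (by omega)
    have h4 := Nat.mul_le_mul_left s h2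
    nlinarith
  have hsub : ¬ X ⊆ X' := by
    intro hs
    obtain ⟨y, hy, hyX⟩ := Finset.exists_of_ssubset (hs.ssubset_of_ne hne)
    have := hframe X hXC hX y (hXC' hy) hyX (hmem' y hy)
    exact hne (Finset.eq_of_subset_of_card_le hs (by omega))
  have hsub' : ¬ X' ⊆ X := by
    intro hs
    obtain ⟨y, hy, hyX⟩ := Finset.exists_of_ssubset (hs.ssubset_of_ne hne.symm)
    have := hframe X' hXC' hX' y (hXC hy) hyX (hmem y hy)
    exact hne (Finset.eq_of_subset_of_card_le hs (by omega)).symm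
  obtain ⟨x, hx, hxX'⟩ := Finset.not_subset.1 hsub
  obtain ⟨y, hy, hyX⟩ := Finset.not_subset.1 hsub'
  have hcard : X.card = t := hXt.antisymm (hframe X hXC hX y (hXC' hy) hyX (hmem' y hy))
  have hcard' : X'.card = t :=
    hXt'.antisymm (hframe X' hXC' hX' x (hXC hx) hxX' (hmem x hx))
  obtain ⟨s, rfl⟩ : ∃ s, t = s + 3 := ⟨t - 3, by omega⟩
  by_cases htwo : ∃ z ∈ X, z ∉ X' ∧ z ≠ x
  · obtain ⟨z, hz, hzX', hzx⟩ := htwo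
    have hc1 := Finset.card_insert_of_notMem hxX'
    have hc2 : (insert z (insert x X')).card = (insert x X').card + 1 :=
      Finset.card_insert_of_notMem (by simp [hzx, hzX'])
    have h1 := hC (insert z (insert x X'))
      (Finset.insert_subset (hXC hz) (Finset.insert_subset (hXC hx) hXC')) (by omega) (by omega)
    have h2 : symbolCount (insert z (insert x X')) ≤ n * (s + 3) := symbolCount_le_mul fun j => by
      rw [Finset.image_insert, Finset.image_insert, Finset.insert_eq_of_mem (hmem x hx j),
        Finset.insert_eq_of_mem (hmem z hz j)]
      exact Finset.card_image_le.trans hXt'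
    rw [hc2, hc1, hcard'] at h1
    simp only [Nat.add_sub_cancel, show s + 3 - 1 = s + 2 by omega] at h1
    have h4 := Nat.mul_le_mul_left (s + 2) h2
    nlinarith
  · push Not at htwo
    have hXX' : X \ X' = {x} := by
      ext z
      simp only [Finset.mem_sdiff, Finset.mem_singleton]
      exact ⟨fun hz => htwo z hz.1 hz.2, fun hz => hz ▸ ⟨hx, hxX'⟩⟩
    have hone : (X' \ X).card = 1 := by
      rw [← Finset.card_sdiff_comm (hcard.trans hcard'.symm), hXX', Finset.card_singleton]
    have hX'y : ∀ z ∈ X', z ∉ X → z = y := fun z hz hzX =>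
      Finset.card_le_one.1 hone.le z (Finset.mem_sdiff.2 ⟨hz, hzX⟩) y
        (Finset.mem_sdiff.2 ⟨hy, hyX⟩)
    have hxy : x ≠ y := fun e => hxX' (e ▸ hy)
    have hI : (X ∩ X').card = s + 2 := by
      have := Finset.card_sdiff_add_card_inter X X'
      rw [hXX', Finset.card_singleton] at this
      omega
    have hc1 := Finset.card_insert_of_notMem hxX'
    have h1 := hC (insert x X') (Finset.insert_subset (hXC hx) hXC') (by omega) (by omega)
    have h2 := hC {x, y} (Finset.insert_subset (hXC hx)
      (Finset.singleton_subset_iff.2 (hXC' hy))) (Finset.card_pair hxy).ge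
      (by rw [Finset.card_pair hxy]; omega)
    have h3 : symbolCount (insert x X') + symbolCount {x, y} ≤ n * (s + 4) := by
      rw [symbolCount, symbolCount, ← Finset.sum_add_distrib]
      refine (Finset.sum_le_card_nsmul _ _ (s + 4) fun j _ => ?_).trans (by simp)
      rw [Finset.image_insert, Finset.insert_eq_of_mem (hmem x hx j)]
      by_cases hj : x j = y j
      · have h4 : (X'.image (· j)).card ≤ s + 3 := Finset.card_image_le.trans hXt'
        have h5 : (Finset.image (· j) {x, y}).card = 1 := by simp [Finset.image_insert, hj]
        omega
      · have h4 : X'.image (· j) ⊆ (X ∩ X').image (· j) := by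
          intro a ha
          obtain ⟨z, hz, rfl⟩ := Finset.mem_image.1 ha
          by_cases hzX : z ∈ X
          · exact Finset.mem_image_of_mem (· j) (Finset.mem_inter.2 ⟨hzX, hz⟩)
          · obtain rfl := hX'y z hz hzX
            obtain ⟨w, hw, hwj⟩ := Finset.mem_image.1 (hmem' z hz j)
            by_cases hwX' : w ∈ X'
            · exact Finset.mem_image.2 ⟨w, Finset.mem_inter.2 ⟨hw, hwX'⟩, hwj⟩
            · obtain rfl := htwo w hw hwX'
              exact absurd hwj hj
        have h5 : (X'.image (· j)).card ≤ s + 2 :=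
          (Finset.card_le_card h4).trans (Finset.card_image_le.trans hI.le)
        have h6 : (Finset.image (· j) {x, y}).card ≤ 2 :=
          Finset.card_image_le.trans Finset.card_le_two
        omega
    rw [hc1, hcard'] at h1
    rw [Finset.card_pair hxy] at h2
    simp only [Nat.add_sub_cancel, show s + 3 - 1 = s + 2 by omega] at h1 h2
    have h4 := Nat.mul_le_mul_left (s + 2) h3
    nlinarith

theorem separable_t_asymptotic_lower_bound (n t : ℕ) (hn : 2 ≤ n) (ht : 3 ≤ t) :
    ∃ κ : ℝ, 0 < κ ∧ ∃ Q : ℕ, ∀ q : ℕ, Q ≤ q →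
      ∃ C : Finset (Fin n → Fin q),
        (∀ X X' : Finset (Fin n → Fin q), X ⊆ C → X' ⊆ C →
          X.Nonempty → X'.Nonempty → X.card ≤ t → X'.card ≤ t → X ≠ X' →
          desc (X : Set (Fin n → Fin q)) ≠ desc (X' : Set (Fin n → Fin q))) ∧
        κ * (q : ℝ) ^ ((n : ℝ) / ((t : ℝ) - 1)) ≤ C.card := by
  obtain ⟨κ, hκ, h⟩ := exists_code_symbolCount n t (by omega)
  refine ⟨κ, hκ, 1, fun q hq => ?_⟩
  obtain ⟨C, hC, hcard⟩ := h q hq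
  exact ⟨C, fun X X' hX hX' hne hne' ht1 ht2 hXX' =>
    desc_ne_of_symbolCount ht hC hX hX' hne hne' ht1 ht2 hXX', hcard⟩
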